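/- Two-dimensional Sobolev product estimate (necessity of scaling condition): if the estimate ‖fg‖_{H^{-s₀}(ℝ²)} ≤ C ‖f‖_{H^{s₁}(ℝ²)} ‖g‖_{H^{s₂}(ℝ²)} holds for all Schwartz functions f, g with a constant C independent of f and g, then s₀ + s₁ + s₂ ≥ max(s₀, s₁, s₂). -/

import Mathlib

open MeasureTheory
open scoped FourierTransform ENNReal

noncomputable section

/-- Japanese bracket `⟨r⟩ = (1 + r²)^{1/2}`. -/
def jb (r : ℝ) : ℝ := Real.sqrt (1 + r ^ 2)

/-- The (inhomogeneous) Sobolev `H^s(ℝ²)` norm,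
`‖f‖_{H^s} = ‖⟨ξ⟩^s f̂(ξ)‖_{L²_ξ}`, as an `ℝ≥0∞`-valued quantity. -/
def sobNorm (s : ℝ) (f : EuclideanSpace ℝ (Fin 2) → ℂ) : ℝ≥0∞ :=
  (∫⁻ ξ : EuclideanSpace ℝ (Fin 2),
      ENNReal.ofReal (jb ‖ξ‖ ^ (2 * s)) * (‖𝓕 f ξ‖₊ : ℝ≥0∞) ^ 2) ^ (1/2 : ℝ)

lemma jb_pos (r : ℝ) : 0 < jb r := Real.sqrt_pos.2 (by positivity)

lemma one_le_jb (r : ℝ) : 1 ≤ jb r := by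
  rw [jb, Real.one_le_sqrt]; nlinarith [sq_nonneg r]

lemma jb_le_one_add (r : ℝ) (hr : 0 ≤ r) : jb r ≤ 1 + r := by
  rw [jb, Real.sqrt_le_left (by positivity)]; nlinarith

lemma le_jb (r : ℝ) : r ≤ jb r := Real.le_sqrt_of_sq_le (by linarith)

lemma continuous_jb : Continuous jb := by unfold jb; fun_prop

lemma jb_le (a b c : ℝ) (ha : 0 ≤ a) (h : a ≤ b + c) : jb a ≤ 2 * (jb b * jb c) := by
  have hb : jb b ^ 2 = 1 + b ^ 2 := Real.sq_sqrt (by positivity)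
  have hc : jb c ^ 2 = 1 + c ^ 2 := Real.sq_sqrt (by positivity)
  have := jb_pos b
  have := jb_pos c
  refine (Real.sqrt_le_left (by positivity)).2 ?_
  rw [mul_pow, mul_pow, hb, hc]
  nlinarith [sq_nonneg (b - c), sq_nonneg (b * c), sq_nonneg b, sq_nonneg c,
    mul_self_le_mul_self ha h]

abbrev E2 := EuclideanSpace ℝ (Fin 2)

lemma peetre_nonneg (t : ℝ) (ht : 0 ≤ t) (x y z : E2) (h : ‖x‖ ≤ ‖y‖ + ‖z‖) :
    jb ‖x‖ ^ t ≤ 2 ^ t * (jb ‖y‖ ^ t * jb ‖z‖ ^ t) := by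
  have h1 := (jb_pos ‖y‖).le
  have h2 := (jb_pos ‖z‖).le
  rw [← Real.mul_rpow h1 h2, ← Real.mul_rpow (by norm_num) (by positivity)]
  exact Real.rpow_le_rpow (jb_pos _).le (jb_le _ _ _ (norm_nonneg _) h) ht

lemma peetre (t : ℝ) (x y z : E2) (h : ‖x‖ ≤ ‖y‖ + ‖z‖) (h' : ‖y‖ ≤ ‖x‖ + ‖z‖) :
    jb ‖x‖ ^ t ≤ 2 ^ |t| * (jb ‖y‖ ^ t * jb ‖z‖ ^ |t|) := by
  rcases le_or_gt 0 t with ht | ht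
  · rw [abs_of_nonneg ht]; exact peetre_nonneg t ht x y z h
  · rw [abs_of_neg ht]
    have := peetre_nonneg (-t) (by linarith) y x z h'
    have hx := Real.rpow_pos_of_pos (jb_pos ‖x‖) t
    have hy := Real.rpow_pos_of_pos (jb_pos ‖y‖) t
    have ex : jb ‖x‖ ^ t * jb ‖x‖ ^ (-t) = 1 := by
      rw [← Real.rpow_add (jb_pos _)]; simp
    have ey : jb ‖y‖ ^ t * jb ‖y‖ ^ (-t) = 1 := by
      rw [← Real.rpow_add (jb_pos _)]; simp
    calc jb ‖x‖ ^ t = jb ‖x‖ ^ t * jb ‖y‖ ^ t * jb ‖y‖ ^ (-t) := by rw [mul_assoc, ey, mul_one]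
      _ ≤ jb ‖x‖ ^ t * jb ‖y‖ ^ t * (2 ^ (-t) * (jb ‖x‖ ^ (-t) * jb ‖z‖ ^ (-t))) := by gcongr
      _ = (jb ‖x‖ ^ t * jb ‖x‖ ^ (-t)) * (2 ^ (-t) * (jb ‖y‖ ^ t * jb ‖z‖ ^ (-t))) := by ring
      _ = _ := by rw [ex, one_mul]

/-- modulation -/
def modu (η : E2) (f : E2 → ℂ) : E2 → ℂ := fun x => (Real.fourierChar (inner ℝ x η) : ℂ) * f x

lemma fourier_modu (η : E2) (f : E2 → ℂ) (ξ : E2) : 𝓕 (modu η f) ξ = 𝓕 f (ξ - η) := by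
  rw [Real.fourier_eq, Real.fourier_eq]
  congr 1
  ext v
  simp only [modu, Circle.smul_def, smul_eq_mul]
  rw [← mul_assoc, ← Circle.coe_mul, ← AddChar.map_add_eq_mul, inner_sub_right]
  congr 3
  ring

lemma sobNorm_modu (s : ℝ) (η : E2) (f : E2 → ℂ) : sobNorm s (modu η f) =
    (∫⁻ ξ : E2, ENNReal.ofReal (jb ‖ξ + η‖ ^ (2 * s)) * (‖𝓕 f ξ‖₊ : ℝ≥0∞) ^ 2) ^ (1/2 : ℝ) := by
  unfold sobNorm
  simp_rw [fourier_modu]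
  rw [← lintegral_add_right_eq_self _ η]
  simp

lemma aux_pull (c : ℝ) (hc : 0 ≤ c) (w v : E2 → ℝ) (F : E2 → ℝ≥0∞) 
    (h : ∀ ξ, ENNReal.ofReal (w ξ) ≤ ENNReal.ofReal (c ^ 2) * ENNReal.ofReal (v ξ)) :
    (∫⁻ ξ, ENNReal.ofReal (w ξ) * F ξ) ^ (1/2 : ℝ) ≤
      ENNReal.ofReal c * (∫⁻ ξ, ENNReal.ofReal (v ξ) * F ξ) ^ (1/2 : ℝ) := by
  have h1 : ENNReal.ofReal c = ENNReal.ofReal (c ^ 2) ^ (1/2 : ℝ) := by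
    rw [ENNReal.ofReal_rpow_of_nonneg (by positivity) (by norm_num), ← Real.sqrt_eq_rpow,
      Real.sqrt_sq hc]
  rw [h1, ← ENNReal.mul_rpow_of_nonneg _ _ (by norm_num)]
  refine ENNReal.rpow_le_rpow ?_ (by norm_num)
  rw [← lintegral_const_mul' _ _ ENNReal.ofReal_ne_top]
  refine lintegral_mono fun ξ => ?_
  rw [← mul_assoc]
  exact mul_le_mul_left (h ξ) _

lemma rpow_two_mul' (x s : ℝ) (hx : 0 ≤ x) : x ^ (2 * s) = (x ^ s) ^ 2 := by
  rw [mul_comm, Real.rpow_mul hx]; norm_cast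

lemma upper (s : ℝ) (η : E2) (f : E2 → ℂ) : sobNorm s (modu η f) ≤
    ENNReal.ofReal (2 ^ |s| * jb ‖η‖ ^ s) * sobNorm |s| f := by
  have := jb_pos ‖η‖
  rw [sobNorm_modu]
  refine aux_pull _ (by positivity) _ _ _ fun ξ => ?_
  rw [← ENNReal.ofReal_mul (by positivity)]
  apply ENNReal.ofReal_le_ofReal
  have h := peetre s (ξ + η) η ξ (by rw [add_comm ξ]; exact norm_add_le _ _)
    (by simpa using norm_sub_le (ξ + η) ξ)
  rw [rpow_two_mul' _ _ (jb_pos _).le, rpow_two_mul' _ _ (jb_pos _).le, ← mul_pow, mul_assoc]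
  exact pow_le_pow_left₀ (Real.rpow_nonneg (jb_pos _).le _) h 2

lemma lower (s : ℝ) (η : E2) (f : E2 → ℂ) :
    ENNReal.ofReal (jb ‖η‖ ^ s) * sobNorm (-|s|) f ≤
      ENNReal.ofReal (2 ^ |s|) * sobNorm s (modu η f) := by
  have hη := jb_pos ‖η‖
  have e : ENNReal.ofReal (2 ^ |s|) =
      ENNReal.ofReal (jb ‖η‖ ^ s) * ENNReal.ofReal (2 ^ |s| * (jb ‖η‖ ^ s)⁻¹) := by
    rw [← ENNReal.ofReal_mul (by positivity)]
    congr 1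
    field_simp
  rw [sobNorm_modu, e, mul_assoc]
  refine mul_le_mul_right ?_ _
  refine aux_pull _ (by positivity) _ _ _ fun ξ => ?_
  rw [← ENNReal.ofReal_mul (by positivity)]
  apply ENNReal.ofReal_le_ofReal
  have h := peetre s η (ξ + η) ξ (by simpa using norm_sub_le (ξ + η) ξ)
    (by rw [add_comm ξ]; exact norm_add_le _ _)
  rw [rpow_two_mul' _ _ (jb_pos _).le, rpow_two_mul' _ _ (jb_pos _).le, ← mul_pow]
  refine pow_le_pow_left₀ (Real.rpow_nonneg (jb_pos _).le _) ?_ 2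
  have hξ := jb_pos ‖ξ‖
  rw [Real.rpow_neg hξ.le]
  have h1 : 0 < jb ‖η‖ ^ s := by positivity
  have h2 : 0 < jb ‖ξ‖ ^ |s| := by positivity
  rw [inv_le_iff_one_le_mul₀ h2]
  calc (1:ℝ) = (jb ‖η‖ ^ s)⁻¹ * jb ‖η‖ ^ s := by field_simp
    _ ≤ (jb ‖η‖ ^ s)⁻¹ * (2 ^ |s| * (jb ‖ξ + η‖ ^ s * jb ‖ξ‖ ^ |s|)) := by gcongr
    _ = _ := by ring

lemma sobNorm_ne_top (s : ℝ) (f : SchwartzMap E2 ℂ) : sobNorm s f ≠ ⊤ := by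
  unfold sobNorm
  refine ENNReal.rpow_ne_top_of_nonneg (by norm_num) (ne_of_lt ?_)
  obtain ⟨n, hn⟩ := exists_nat_ge (2 * s)
  obtain ⟨M, hM⟩ : ∃ M : ℝ, ∀ ξ, (1 + ‖ξ‖) ^ (n + 3) * ‖𝓕 (f : E2 → ℂ) ξ‖ ≤ M := by
    refine ⟨2 ^ (n + 3) * (Finset.Iic (n + 3, 0)).sup
      (fun m => SchwartzMap.seminorm ℝ m.1 m.2) (𝓕 f), fun ξ => ?_⟩
    have := SchwartzMap.one_add_le_sup_seminorm_apply (𝕜 := ℝ) (m := (n + 3, 0)) (k := n + 3)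
      (n := 0) le_rfl le_rfl (𝓕 f) ξ
    rw [norm_iteratedFDeriv_zero, SchwartzMap.fourier_coe] at this
    exact this
  have key : ∀ ξ : E2, ENNReal.ofReal (jb ‖ξ‖ ^ (2 * s)) * (‖𝓕 (f : E2 → ℂ) ξ‖₊ : ℝ≥0∞) ^ 2 ≤
      ENNReal.ofReal (M ^ 2) * ENNReal.ofReal ((1 + ‖ξ‖) ^ (-3 : ℝ)) := by
    intro ξ
    have e : (‖𝓕 (f : E2 → ℂ) ξ‖₊ : ℝ≥0∞) = ENNReal.ofReal ‖𝓕 (f : E2 → ℂ) ξ‖ := by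
      rw [ofReal_norm]; rfl
    rw [e, ← ENNReal.ofReal_pow (norm_nonneg _),
      ← ENNReal.ofReal_mul (Real.rpow_nonneg (jb_pos _).le _), ← ENNReal.ofReal_mul (by positivity)]
    apply ENNReal.ofReal_le_ofReal
    have hp : 0 < 1 + ‖ξ‖ := by positivity
    have h1 : (1:ℝ) ≤ 1 + ‖ξ‖ := by linarith [norm_nonneg ξ]
    have h3 : (1 + ‖ξ‖) ^ (-3 : ℝ) = ((1 + ‖ξ‖) ^ 3)⁻¹ := by
      rw [Real.rpow_neg hp.le]; norm_cast
    have h4 : jb ‖ξ‖ ^ (2 * s) ≤ (1 + ‖ξ‖) ^ n := by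
      calc jb ‖ξ‖ ^ (2 * s) ≤ jb ‖ξ‖ ^ (n : ℝ) :=
            Real.rpow_le_rpow_of_exponent_le (one_le_jb _) hn
        _ = jb ‖ξ‖ ^ n := Real.rpow_natCast _ _
        _ ≤ _ := pow_le_pow_left₀ (jb_pos _).le (jb_le_one_add _ (norm_nonneg _)) n
    rw [h3, ← div_eq_mul_inv, le_div_iff₀ (by positivity)]
    have h5 : (1 + ‖ξ‖) ^ n * (1 + ‖ξ‖) ^ 3 ≤ ((1 + ‖ξ‖) ^ (n + 3)) ^ 2 := by
      rw [← pow_add, ← pow_mul]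
      exact pow_le_pow_right₀ h1 (by omega)
    calc jb ‖ξ‖ ^ (2 * s) * ‖𝓕 (f : E2 → ℂ) ξ‖ ^ 2 * (1 + ‖ξ‖) ^ 3
        ≤ (1 + ‖ξ‖) ^ n * ‖𝓕 (f : E2 → ℂ) ξ‖ ^ 2 * (1 + ‖ξ‖) ^ 3 := by gcongr
      _ = ((1 + ‖ξ‖) ^ n * (1 + ‖ξ‖) ^ 3) * ‖𝓕 (f : E2 → ℂ) ξ‖ ^ 2 := by ring
      _ ≤ ((1 + ‖ξ‖) ^ (n + 3)) ^ 2 * ‖𝓕 (f : E2 → ℂ) ξ‖ ^ 2 := by gcongr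
      _ = ((1 + ‖ξ‖) ^ (n + 3) * ‖𝓕 (f : E2 → ℂ) ξ‖) ^ 2 := by ring
      _ ≤ M ^ 2 := pow_le_pow_left₀ (by positivity) (hM ξ) 2
  refine (lintegral_mono key).trans_lt ?_
  rw [lintegral_const_mul' _ _ ENNReal.ofReal_ne_top]
  exact ENNReal.mul_lt_top ENNReal.ofReal_lt_top (finite_integral_one_add_norm (by simp; norm_num))

lemma sobNorm_ne_zero (s : ℝ) (f : SchwartzMap E2 ℂ) (hf : f ≠ 0) : sobNorm s f ≠ 0 := by
  intro h0
  apply hf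
  unfold sobNorm at h0
  rw [ENNReal.rpow_eq_zero_iff_of_pos (by norm_num)] at h0
  have hc : Continuous (𝓕 (f : E2 → ℂ)) := by
    rw [← SchwartzMap.fourier_coe]; exact (𝓕 f).continuous
  have hj := continuous_jb
  rw [lintegral_eq_zero_iff] at h0
  · have h1 : 𝓕 (f : E2 → ℂ) =ᵐ[volume] fun _ => 0 := by
      filter_upwards [h0] with ξ hξ
      have : 0 < jb ‖ξ‖ ^ (2 * s) := Real.rpow_pos_of_pos (jb_pos _) _
      simpa [this.not_ge] using hξ
    have h2 := hc.ae_eq_iff_eq volume continuous_const |>.1 h1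
    have h3 : 𝓕 f = 0 := by
      ext ξ
      rw [SchwartzMap.fourier_coe, h2]; rfl
    have h4 := FourierPair.fourierInv_fourier_eq (F := SchwartzMap E2 ℂ) f
    rw [h3] at h4
    rw [← h4]
    exact FourierTransform.fourierInv_zero
  · have hm : Measurable fun ξ : E2 => jb ‖ξ‖ := (hj.comp continuous_norm).measurable
    have := hc.measurable
    fun_prop

lemma modu_contDiff (η : E2) (f : E2 → ℂ) (hf : ContDiff ℝ (⊤ : ℕ∞) f) :
    ContDiff ℝ (⊤ : ℕ∞) (modu η f) := by
  unfold modu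
  simp_rw [Real.fourierChar_apply]
  have h : ContDiff ℝ (⊤ : ℕ∞) fun x : E2 => (((2 * Real.pi * inner ℝ x η : ℝ)) : ℂ) :=
    Complex.ofRealCLM.contDiff.comp (contDiff_const.mul (contDiff_id.inner ℝ contDiff_const))
  exact ((h.mul contDiff_const).cexp).mul hf

lemma modu_hcs (η : E2) (f : E2 → ℂ) (hf : HasCompactSupport f) :
    HasCompactSupport (modu η f) := hf.mul_left

lemma exists_bump : ∃ f : E2 → ℂ, HasCompactSupport f ∧ ContDiff ℝ (⊤ : ℕ∞) f ∧ f 0 = 1 := by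
  let b : ContDiffBump (0 : E2) := ⟨1, 2, by norm_num, by norm_num⟩
  refine ⟨fun x => (b x : ℂ), ?_, ?_, ?_⟩
  · exact b.hasCompactSupport.comp_left (g := fun r : ℝ => (r : ℂ)) (by simp)
  · exact Complex.ofRealCLM.contDiff.comp b.contDiff
  · have : b 0 = 1 := b.one_of_mem_closedBall (by simp [b])
    simp [this]

lemma modu_mul (η₁ η₂ : E2) (f g : E2 → ℂ) :
    (fun x => modu η₁ f x * modu η₂ g x) = modu (η₁ + η₂) (fun x => f x * g x) := by
  ext x
  simp only [modu]
  rw [inner_add_right, AddChar.map_add_eq_mul, Circle.coe_mul]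
  ring

lemma main_ineq (s₀ s₁ s₂ : ℝ) (C : ℝ≥0∞) (hC : C ≠ ⊤)
    (h : ∀ f g : SchwartzMap (EuclideanSpace ℝ (Fin 2)) ℂ,
      sobNorm (-s₀) (fun x => f x * g x) ≤ C * sobNorm s₁ f * sobNorm s₂ g) :
    ∃ K : ℝ, ∀ η₁ η₂ : E2,
      jb ‖η₁ + η₂‖ ^ (-s₀) ≤ K * (jb ‖η₁‖ ^ s₁ * jb ‖η₂‖ ^ s₂) := by
  obtain ⟨f, hf, hfs, hf0⟩ := exists_bump
  let φ : SchwartzMap E2 ℂ := hf.toSchwartzMap hfs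
  let φ2 : SchwartzMap E2 ℂ := (hf.mul_left (f := f)).toSchwartzMap (hfs.mul hfs)
  have hφ2 : φ2 ≠ 0 := by
    intro h0
    have : φ2 0 = f 0 * f 0 := rfl
    rw [h0, hf0] at this
    simp at this
  set a := sobNorm (-|-s₀|) φ2 with ha
  have ha0 : a ≠ 0 := sobNorm_ne_zero _ _ hφ2
  have hat : a ≠ ⊤ := sobNorm_ne_top _ _
  set D : ℝ≥0∞ := ENNReal.ofReal (2 ^ |-s₀|) * (C * (ENNReal.ofReal (2 ^ |s₁|) * sobNorm |s₁| φ)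
    * (ENNReal.ofReal (2 ^ |s₂|) * sobNorm |s₂| φ)) with hD
  have hDt : D ≠ ⊤ := by
    have := sobNorm_ne_top |s₁| φ
    have := sobNorm_ne_top |s₂| φ
    finiteness
  refine ⟨(D / a).toReal, fun η₁ η₂ => ?_⟩
  have p1 : 0 < jb ‖η₁‖ ^ s₁ := Real.rpow_pos_of_pos (jb_pos _) _
  have p2 : 0 < jb ‖η₂‖ ^ s₂ := Real.rpow_pos_of_pos (jb_pos _) _
  have key : ENNReal.ofReal (jb ‖η₁ + η₂‖ ^ (-s₀)) * a ≤
      D * ENNReal.ofReal (jb ‖η₁‖ ^ s₁ * jb ‖η₂‖ ^ s₂) := by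
    have h1 := lower (-s₀) (η₁ + η₂) φ2
    have h2 := h ((modu_hcs η₁ f hf).toSchwartzMap (modu_contDiff η₁ f hfs))
      ((modu_hcs η₂ f hf).toSchwartzMap (modu_contDiff η₂ f hfs))
    have h2' : sobNorm (-s₀) (modu (η₁ + η₂) φ2) ≤
        C * sobNorm s₁ (modu η₁ φ) * sobNorm s₂ (modu η₂ φ) := by
      have e := modu_mul η₁ η₂ f f
      change sobNorm (-s₀) (modu (η₁ + η₂) (fun x => f x * f x)) ≤ _
      rw [← e]
      exact h2
    refine h1.trans ?_
    calc _ ≤ ENNReal.ofReal (2 ^ |-s₀|) *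
          (C * (ENNReal.ofReal (2 ^ |s₁| * jb ‖η₁‖ ^ s₁) * sobNorm |s₁| φ) *
            (ENNReal.ofReal (2 ^ |s₂| * jb ‖η₂‖ ^ s₂) * sobNorm |s₂| φ)) := by
          refine mul_le_mul_right (h2'.trans ?_) _
          exact mul_le_mul' (mul_le_mul_right (upper s₁ η₁ φ) _) (upper s₂ η₂ φ)
      _ = _ := by
          rw [ENNReal.ofReal_mul (by positivity), ENNReal.ofReal_mul (by positivity),
            ENNReal.ofReal_mul p1.le, hD]
          ring
  rw [← ENNReal.le_div_iff_mul_le (Or.inl ha0) (Or.inl hat)] at key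
  have hDa : D / a ≠ ⊤ := ENNReal.div_ne_top hDt ha0
  rw [mul_comm D, mul_div_assoc, mul_comm, ← ENNReal.ofReal_toReal hDa,
    ← ENNReal.ofReal_mul ENNReal.toReal_nonneg] at key
  exact (ENNReal.ofReal_le_ofReal_iff (by positivity)).1 key

lemma exponent_nonneg (K a : ℝ) (h : ∀ t : ℝ, 0 ≤ t → 1 ≤ K * jb t ^ a) : 0 ≤ a := by
  by_contra! ha
  have h1 : Filter.Tendsto jb Filter.atTop Filter.atTop :=
    Filter.tendsto_atTop_mono le_jb Filter.tendsto_id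
  have h2 := ((tendsto_rpow_neg_atTop (y := -a) (by linarith)).comp h1).const_mul K
  have h3 : (1:ℝ) ≤ K * 0 := by
    refine ge_of_tendsto h2 ?_
    filter_upwards [Filter.eventually_ge_atTop 0] with t ht
    simpa using h t ht
  norm_num at h3

/-- **necessity of the scaling condition.** If the 2D product estimate
`‖fg‖_{H^{-s₀}} ≤ C ‖f‖_{H^{s₁}} ‖g‖_{H^{s₂}}` holds for all Schwartz functions `f, g`
with a constant `C` independent of `f` and `g`, then `s₀+s₁+s₂ ≥ max(s₀,s₁,s₂)`. -/
theorem sobolev_product_necessity (s₀ s₁ s₂ : ℝ) (C : ℝ≥0∞) (hC : C ≠ ⊤)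
    (h : ∀ f g : SchwartzMap (EuclideanSpace ℝ (Fin 2)) ℂ,
      sobNorm (-s₀) (fun x => f x * g x) ≤ C * sobNorm s₁ f * sobNorm s₂ g) :
    max s₀ (max s₁ s₂) ≤ s₀ + s₁ + s₂ := by
  obtain ⟨K, hK⟩ := main_ineq s₀ s₁ s₂ C hC h
  have j0 : jb 0 = 1 := by simp [jb]
  have hv : ∀ t : ℝ, 0 ≤ t → ∃ v : E2, ‖v‖ = t := fun t ht => by
    exact exists_norm_eq E2 ht
  have hadd : ∀ t x : ℝ, 1 = jb t ^ x * jb t ^ (-x) := fun t x => by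
    rw [← Real.rpow_add (jb_pos t)]; simp
  have h12 : 0 ≤ s₁ + s₂ := exponent_nonneg K _ fun t ht => by
    obtain ⟨v, hv⟩ := hv t ht
    have := hK v (-v)
    simpa [j0, hv, Real.rpow_add (jb_pos t)] using this
  have h01 : 0 ≤ s₀ + s₁ := exponent_nonneg K _ fun t ht => by
    obtain ⟨v, hv⟩ := hv t ht
    have := hK v 0
    simp only [add_zero, hv, norm_zero, j0, Real.one_rpow, mul_one] at this
    have hp : 0 < jb t ^ s₀ := Real.rpow_pos_of_pos (jb_pos _) _
    rw [Real.rpow_add (jb_pos t)]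
    calc 1 = jb t ^ s₀ * jb t ^ (-s₀) := hadd t s₀
      _ ≤ jb t ^ s₀ * (K * jb t ^ s₁) := by gcongr
      _ = _ := by ring
  have h02 : 0 ≤ s₀ + s₂ := exponent_nonneg K _ fun t ht => by
    obtain ⟨v, hv⟩ := hv t ht
    have := hK 0 v
    simp only [zero_add, hv, norm_zero, j0, Real.one_rpow, one_mul] at this
    have hp : 0 < jb t ^ s₀ := Real.rpow_pos_of_pos (jb_pos _) _
    rw [Real.rpow_add (jb_pos t)]
    calc 1 = jb t ^ s₀ * jb t ^ (-s₀) := hadd t s₀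
      _ ≤ jb t ^ s₀ * (K * jb t ^ s₂) := by gcongr
      _ = _ := by ring
  refine max_le (by linarith) (max_le (by linarith) (by linarith))

end
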